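/- Let λ > 0, 0 < α₀ < 1, and t₀ ≥ e^{1 − γ_EM} · e^{2/α₀}. Define p₁(α) = −Γ(α) / (λ² t₀^{α+1} Γ(−α)) for α ∈ (0, 1). Then p₁ is differentiable on (α₀, 1) and its derivative satisfies p₁'(α) ≤ −Γ(α) / (λ² t₀^{α+1}) for every α ∈ (α₀, 1). -/

import Mathlib

open Real

lemma differentiableAt_Gamma_of_pos {x : ℝ} (hx : 0 < x) : DifferentiableAt ℝ Real.Gamma x :=
  Real.differentiableAt_Gamma fun m => by
    have : (0 : ℝ) ≤ m := m.cast_nonneg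
    linarith

/-- The logarithmic derivative of the Gamma function is monotone on `(0, ∞)`. -/
lemma deriv_Gamma_div_Gamma_le {x y : ℝ} (hx : 0 < x) (hxy : x ≤ y) :
    deriv Real.Gamma x / Real.Gamma x ≤ deriv Real.Gamma y / Real.Gamma y := by
  have hd : ∀ z : ℝ, 0 < z →
      HasDerivAt (Real.log ∘ Real.Gamma) (deriv Real.Gamma z / Real.Gamma z) z := fun z hz =>
    (differentiableAt_Gamma_of_pos hz).hasDerivAt.log (Real.Gamma_pos_of_pos hz).ne'
  have h := Real.convexOn_log_Gamma.monotoneOn_deriv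
    (fun z hz => (hd z hz).differentiableAt) hx (hx.trans_le hxy) hxy
  rwa [(hd x hx).deriv, (hd y (hx.trans_le hxy)).deriv] at h

lemma deriv_Gamma_div_Gamma_two :
    deriv Real.Gamma 2 / Real.Gamma 2 = 1 - Real.eulerMascheroniConstant := by
  have h := Real.deriv_Gamma_nat 1
  norm_num at h
  rw [h, Real.Gamma_two]
  ring

lemma Gamma_le_one_of_mem_Icc {x : ℝ} (h1 : 1 ≤ x) (h2 : x ≤ 2) : Real.Gamma x ≤ 1 := by
  have h := Real.convexOn_Gamma.2 (Set.mem_Ioi.2 one_pos) (Set.mem_Ioi.2 two_pos)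
    (show 0 ≤ 2 - x by linarith) (show 0 ≤ x - 1 by linarith) (by ring)
  simp only [smul_eq_mul, Real.Gamma_one, Real.Gamma_two] at h
  ring_nf at h
  exact h

lemma neg_Gamma_div_Gamma_neg {x : ℝ} (h0 : 0 < x) (h1 : x < 1) :
    -Real.Gamma x / Real.Gamma (-x) = (1 - x) * Real.Gamma (1 + x) / Real.Gamma (2 - x) := by
  have e1 : Real.Gamma (1 + x) = x * Real.Gamma x := by
    rw [add_comm, Real.Gamma_add_one h0.ne']
  have e2 : Real.Gamma (1 - x) = -x * Real.Gamma (-x) := by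
    rw [← Real.Gamma_add_one (neg_ne_zero.2 h0.ne')]; ring_nf
  have e3 : Real.Gamma (2 - x) = (1 - x) * Real.Gamma (1 - x) := by
    rw [← Real.Gamma_add_one (by linarith)]; ring_nf
  have p : 0 < Real.Gamma (1 - x) := Real.Gamma_pos_of_pos (by linarith)
  have hn : Real.Gamma (-x) ≠ 0 := by
    intro h; rw [h] at e2; simp at e2; linarith
  have hx : 1 - x ≠ 0 := by linarith
  rw [e3, e1, e2]
  field_simp

/-- For `λ > 0`, `0 < α₀ < 1` and `t₀ ≥ e^{1 − γ_EM} e^{2/α₀}`, the function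
`p₁(α) = −Γ(α)/(λ² t₀^{α+1} Γ(−α))` is differentiable on `(α₀, 1)` with
`p₁'(α) ≤ −Γ(α)/(λ² t₀^{α+1})` there. -/
theorem stmt8 (l α₀ t₀ : ℝ) (hl : 0 < l) (hα₀ : 0 < α₀) (hα₀1 : α₀ < 1)
    (ht₀ : Real.exp (1 - Real.eulerMascheroniConstant) * Real.exp (2 / α₀) ≤ t₀) :
    ∀ α ∈ Set.Ioo α₀ 1,
      DifferentiableAt ℝ
        (fun β : ℝ => -Real.Gamma β / (l ^ 2 * t₀ ^ (β + 1) * Real.Gamma (-β))) α ∧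
      deriv (fun β : ℝ => -Real.Gamma β / (l ^ 2 * t₀ ^ (β + 1) * Real.Gamma (-β))) α
        ≤ -Real.Gamma α / (l ^ 2 * t₀ ^ (α + 1)) := by
  rintro α ⟨hα, hα1⟩
  have hα0 : 0 < α := hα₀.trans hα
  have ht : 0 < t₀ := lt_of_lt_of_le (by positivity) ht₀
  have hL : 1 - Real.eulerMascheroniConstant + 2 / α ≤ Real.log t₀ := by
    rw [← Real.exp_add] at ht₀
    have h1 := (Real.le_log_iff_exp_le ht).2 ht₀
    have h2 : 2 / α ≤ 2 / α₀ := by gcongr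
    linarith
  have hA : 0 < Real.Gamma (1 + α) := Real.Gamma_pos_of_pos (by linarith)
  have hB : 0 < Real.Gamma (2 - α) := Real.Gamma_pos_of_pos (by linarith)
  have hT : 0 < t₀ ^ (α + 1) := Real.rpow_pos_of_pos ht _
  have ha : deriv Real.Gamma (1 + α) / Real.Gamma (1 + α) ≤ 1 - Real.eulerMascheroniConstant :=
    deriv_Gamma_div_Gamma_two ▸ deriv_Gamma_div_Gamma_le (by linarith) (by linarith)
  have hb : deriv Real.Gamma (2 - α) / Real.Gamma (2 - α) ≤ 1 - Real.eulerMascheroniConstant :=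
    deriv_Gamma_div_Gamma_two ▸ deriv_Gamma_div_Gamma_le (by linarith) (by linarith)
  have hB1 : Real.Gamma (2 - α) ≤ 1 := Gamma_le_one_of_mem_Icc (by linarith) (by linarith)
  have hGA : Real.Gamma α = Real.Gamma (1 + α) / α := by
    rw [add_comm, Real.Gamma_add_one hα0.ne']; field_simp
  have heq : (fun β : ℝ => -Real.Gamma β / (l ^ 2 * t₀ ^ (β + 1) * Real.Gamma (-β)))
      =ᶠ[nhds α] fun β => (1 - β) * Real.Gamma (1 + β) /
        (Real.Gamma (2 - β) * (l ^ 2 * t₀ ^ (β + 1))) := by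
    filter_upwards [Ioo_mem_nhds hα0 hα1] with β hβ
    rw [mul_comm _ (Real.Gamma (-β)), ← div_div, neg_Gamma_div_Gamma_neg hβ.1 hβ.2, div_div]
  have dA : HasDerivAt (fun β : ℝ => Real.Gamma (1 + β)) (deriv Real.Gamma (1 + α)) α :=
    (differentiableAt_Gamma_of_pos (by linarith)).hasDerivAt.comp_const_add 1 α
  have dB : HasDerivAt (fun β : ℝ => Real.Gamma (2 - β)) (-deriv Real.Gamma (2 - α)) α :=
    (differentiableAt_Gamma_of_pos (by linarith)).hasDerivAt.comp_const_sub 2 α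
  have dT : HasDerivAt (fun β : ℝ => t₀ ^ (β + 1)) (Real.log t₀ * 1 * t₀ ^ (α + 1)) α :=
    ((hasDerivAt_id α).add_const 1).const_rpow ht
  have hd := ((((hasDerivAt_id α).const_sub 1).mul dA).div
    (dB.mul (dT.const_mul (l ^ 2))) (mul_pos hB (by positivity)).ne').congr_of_eventuallyEq heq
  refine ⟨hd.differentiableAt, ?_⟩
  rw [hd.deriv, hGA]
  simp only [Pi.mul_apply, id]
  generalize deriv Real.Gamma (1 + α) = A' at *
  generalize deriv Real.Gamma (2 - α) = B' at *
  generalize Real.Gamma (1 + α) = A at *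
  generalize Real.Gamma (2 - α) = B at *
  generalize t₀ ^ (α + 1) = T at *
  generalize Real.log t₀ = L at *
  have key : -1 + (1 - α) * (A' / A + B' / B - L) ≤ -B / α := by
    have hγ := Real.one_half_lt_eulerMascheroniConstant
    have h1 : 1 ≤ 1 / α := by rw [le_div_iff₀ hα0]; linarith
    have h2 : 2 / α = 1 / α + 1 / α := by ring
    have h3 : A' / A + B' / B - L ≤ -(1 / α) := by linarith
    have h4 := mul_le_mul_of_nonneg_left h3 (sub_nonneg.2 hα1.le)
    have h5 : B / α ≤ 1 / α := by gcongr
    have h6 : (1 - α) * -(1 / α) = 1 - 1 / α := by field_simp; ring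
    rw [neg_div]
    linarith
  have hC : 0 ≤ A / (B * (l ^ 2 * T)) := by positivity
  have h := mul_le_mul_of_nonneg_left key hC
  have e : A / (B * (l ^ 2 * T)) * (-B / α) = -(A / α) / (l ^ 2 * T) := by field_simp
  rw [e] at h
  refine le_of_eq_of_le ?_ h
  field_simp
  ring
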